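/- arXiv:2105.03816 — 2 statements merged into one kernel-verified Lean document; each statement's English description precedes it below -/
import Mathlib

section
/- For all elements p, q, u, v, c of a commutative ring, setting a₁ = pu, b₁ = qv, a₂ = pv, b₂ = qu, one has a₁·b₁·c = a₂·b₂·c, and H(a₁,b₁,c) − H(a₂,b₂,c) = (u² − v²)(p² − q²)(2c² − (u² + v²)(p² + q²)). In particular, if 2c² = (u² + v²)(p² + q²), then the two triples (a₁,b₁,c) and (a₂,b₂,c) have equal products of sides and equal Heron products, hence (when they form triangles) equal circumradii and equal areas. -/
/-- The Heron product `H(a,b,c) = (a+b+c)(a+b-c)(b+c-a)(c+a-b)`. -/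
def heron {R : Type*} [CommRing R] (a b c : R) : R :=
  (a + b + c) * (a + b - c) * (b + c - a) * (c + a - b)

/-- For `p, q, u, v, c` in a commutative ring, with `a₁ = pu`, `b₁ = qv`, `a₂ = pv`,
`b₂ = qu`, one has `a₁b₁c = a₂b₂c` and
`H(a₁,b₁,c) - H(a₂,b₂,c) = (u² - v²)(p² - q²)(2c² - (u² + v²)(p² + q²))`;
in particular, if `2c² = (u² + v²)(p² + q²)`, then the two triples have equal products of
sides and equal Heron products. -/
theorem common_product_and_heron_difference {R : Type*} [CommRing R]
    (p q u v c a₁ b₁ a₂ b₂ : R)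
    (ha₁ : a₁ = p * u) (hb₁ : b₁ = q * v) (ha₂ : a₂ = p * v) (hb₂ : b₂ = q * u) :
    a₁ * b₁ * c = a₂ * b₂ * c ∧
    heron a₁ b₁ c - heron a₂ b₂ c =
      (u ^ 2 - v ^ 2) * (p ^ 2 - q ^ 2) *
        (2 * c ^ 2 - (u ^ 2 + v ^ 2) * (p ^ 2 + q ^ 2)) ∧
    (2 * c ^ 2 = (u ^ 2 + v ^ 2) * (p ^ 2 + q ^ 2) →
      a₁ * b₁ * c = a₂ * b₂ * c ∧ heron a₁ b₁ c = heron a₂ b₂ c) := by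
  subst ha₁ hb₁ ha₂ hb₂
  have h1 : p * u * (q * v) * c = p * v * (q * u) * c := by ring
  have h2 : heron (p * u) (q * v) c - heron (p * v) (q * u) c =
      (u ^ 2 - v ^ 2) * (p ^ 2 - q ^ 2) *
        (2 * c ^ 2 - (u ^ 2 + v ^ 2) * (p ^ 2 + q ^ 2)) := by
    unfold heron
    ring
  refine ⟨h1, h2, fun h => ⟨h1, ?_⟩⟩
  rw [h, sub_self, mul_zero] at h2
  exact sub_eq_zero.mp h2
end

section
/- For all elements m, n, p, q of a commutative ring, define a₁ = (m²+2mn−n²)p² − (m²−2mn−n²)pq, a₂ = (m²−2mn−n²)p² + (m²+2mn−n²)pq, b₁ = (m²−2mn−n²)pq + (m²+2mn−n²)q², b₂ = (m²+2mn−n²)pq − (m²−2mn−n²)q², and c = (m²+n²)p² + (m²+n²)q². Then a₁·b₁·c = a₂·b₂·c and H(a₁,b₁,c) = H(a₂,b₂,c); that is, the two triangles with sides (a₁,b₁,c) and (a₂,b₂,c) have equal products of sides and equal Heron products, hence a common circumradius and a common area. -/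
/-- For all `m, n, p, q` in a commutative ring, the two triples
`(a₁, b₁, c)` and `(a₂, b₂, c)` defined below have equal products of sides and equal
Heron products, hence a common circumradius and a common area. -/
theorem common_circumradius_and_area_family {R : Type*} [CommRing R]
    (m n p q a₁ a₂ b₁ b₂ c : R)
    (ha₁ : a₁ = (m ^ 2 + 2 * m * n - n ^ 2) * p ^ 2 - (m ^ 2 - 2 * m * n - n ^ 2) * p * q)
    (ha₂ : a₂ = (m ^ 2 - 2 * m * n - n ^ 2) * p ^ 2 + (m ^ 2 + 2 * m * n - n ^ 2) * p * q)
    (hb₁ : b₁ = (m ^ 2 - 2 * m * n - n ^ 2) * p * q + (m ^ 2 + 2 * m * n - n ^ 2) * q ^ 2)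
    (hb₂ : b₂ = (m ^ 2 + 2 * m * n - n ^ 2) * p * q - (m ^ 2 - 2 * m * n - n ^ 2) * q ^ 2)
    (hc : c = (m ^ 2 + n ^ 2) * p ^ 2 + (m ^ 2 + n ^ 2) * q ^ 2) :
    a₁ * b₁ * c = a₂ * b₂ * c ∧ heron a₁ b₁ c = heron a₂ b₂ c := by
  have h1 : a₁ * b₁ = a₂ * b₂ := by
    subst ha₁ ha₂ hb₁ hb₂; ring
  have h2 : a₁ ^ 2 + b₁ ^ 2 + (a₂ ^ 2 + b₂ ^ 2) = 2 * c ^ 2 := by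
    subst ha₁ ha₂ hb₁ hb₂ hc; ring
  refine ⟨by rw [h1], ?_⟩
  unfold heron
  linear_combination 4 * (a₁ * b₁ + a₂ * b₂) * h1
    - (a₁ ^ 2 + b₁ ^ 2 - (a₂ ^ 2 + b₂ ^ 2)) * h2
end
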